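/- Let p be a prime and let G be a group with a normal subgroup H of index p such that H is a finite, nontrivial, abelian p-group. Then there exists a simple virtual endomorphism φ : H → G (i.e., a group homomorphism from H to G whose only φ-invariant normal subgroup of G contained in H is the trivial subgroup) if and only if there exists an element a ∈ G \ H with a^p = 1 (i.e., the extension 1 → H → G → C_p → 1 splits) and every element of H has order dividing p (i.e., H is an elementary abelian p-group). -/

import Mathlib

open Fin.NatCast Fin.CommRing in
lemma exists_shift (F V : Type*) [Field F] [AddCommGroup V] [Module F V] [Module.Finite F V] :
    ∃ (f : V →ₗ[F] V) (g : V →ₗ[F] F), ∀ M : Set V,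
      (∀ x ∈ M, f x ∈ M ∧ g x = 0) → ∀ x ∈ M, x = 0 := by
  obtain ⟨k, ⟨e⟩⟩ : ∃ k : ℕ, Nonempty (V ≃ₗ[F] (Fin k → F)) :=
    ⟨_, ⟨(Module.finBasis F V).equivFun⟩⟩
  rcases k with _ | k
  · refine ⟨0, 0, fun M _ x _ => ?_⟩
    apply e.injective
    exact Subsingleton.elim _ _
  let s : (Fin (k+1) → F) →ₗ[F] (Fin (k+1) → F) :=
    LinearMap.funLeft F F (fun i => i - 1)
  refine ⟨e.symm.toLinearMap ∘ₗ s ∘ₗ e.toLinearMap,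
    (LinearMap.proj (Fin.last k)) ∘ₗ e.toLinearMap, fun M hM => ?_⟩
  have key : ∀ i : ℕ, ∀ x ∈ M, e x (Fin.last k - (i : Fin (k+1))) = 0 := by
    intro i
    induction i with
    | zero => intro x hx; simpa using (hM x hx).2
    | succ i ih =>
      intro x hx
      have := ih _ (hM x hx).1
      simp [s, LinearMap.funLeft_apply] at this
      rw [← this]
      have h : ((i + 1 : ℕ) : Fin (k+1)) = (i : Fin (k+1)) + 1 := Nat.cast_succ i
      rw [h, sub_sub]
  intro x hx
  apply e.injective
  ext j
  have := key (Fin.last k - j : Fin (k+1)).val x hx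
  simpa using this

lemma exists_central (p : ℕ) (hp : p.Prime) (G : Type*) [Group G] (N : Subgroup G) [N.Normal]
    [Finite N] (hN : IsPGroup p N) (hne : N ≠ ⊥) (a : G) (ha : a ^ p = 1) :
    ∃ x ∈ N, x ≠ 1 ∧ a * x = x * a := by
  have : Fact p.Prime := ⟨hp⟩
  let _ : MulAction (Subgroup.zpowers a) N :=
    MulAction.compHom N ((MulAut.conjNormal (H := N)).comp (Subgroup.zpowers a).subtype)
  have hsm : ∀ (g : Subgroup.zpowers a) (n : N), ((g • n : N) : G) = g * n * (g:G)⁻¹ := by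
    intro g n; rfl
  have hA : IsPGroup p (Subgroup.zpowers a) := by
    rintro ⟨_, n, rfl⟩
    refine ⟨1, ?_⟩
    ext
    simp
    rw [← zpow_natCast, zpow_comm, zpow_natCast, ha, one_zpow]
  have hnt : Nontrivial N := N.nontrivial_iff_ne_bot.mpr hne
  obtain ⟨n, hn, hc⟩ := hN.nontrivial_iff_card.mp hnt
  obtain ⟨b, hb, hb1⟩ := hA.exists_fixed_point_of_prime_dvd_card_of_fixed_point N
    (by rw [hc]; exact dvd_pow_self p hn.ne') (a := (1 : N)) (by
      intro g; ext; rw [hsm]; simp)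
  refine ⟨b, b.2, fun h => hb1 (Subtype.ext h.symm), ?_⟩
  have := congrArg Subtype.val (hb ⟨a, Subgroup.mem_zpowers a⟩)
  rw [hsm] at this
  exact mul_inv_eq_iff_eq_mul.mp this

lemma exists_zpow (p : ℕ) (hp : p.Prime) (G : Type*) [Group G]
    (H : Subgroup G) [H.Normal] (hidx : H.index = p) (b : G) (hb : b ∉ H) (g : G) :
    ∃ n : ℤ, g * b ^ n ∈ H := by
  have : Fact p.Prime := ⟨hp⟩
  have hc : Nat.card (G ⧸ H) = p := hidx
  have h1 : (b : G ⧸ H) ≠ 1 := by rwa [Ne, QuotientGroup.eq_one_iff]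
  obtain ⟨n, hn⟩ := mem_zpowers_of_prime_card hc h1 (g' := ((g : G ⧸ H))⁻¹)
  refine ⟨n, ?_⟩
  rw [← QuotientGroup.eq_one_iff]
  simp at hn
  simp [hn]

lemma pow_mem_imp (p : ℕ) (hp : p.Prime) (G : Type*) [Group G]
    (H : Subgroup G) [H.Normal] (a : G) (ha : a ∉ H) (hap : a ^ p = 1)
    (x : ZMod p) (hx : a ^ x.val ∈ H) : x = 0 := by
  have : Fact p.Prime := ⟨hp⟩
  have h1 : (a : G ⧸ H) ≠ 1 := by rwa [Ne, QuotientGroup.eq_one_iff]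
  have ho : orderOf (a : G ⧸ H) = p := orderOf_eq_prime (by
    rw [← QuotientGroup.mk_pow, hap]; rfl) h1
  have : p ∣ x.val := by
    refine ho.symm.dvd.trans ?_
    apply orderOf_dvd_of_pow_eq_one
    rwa [← QuotientGroup.mk_pow, QuotientGroup.eq_one_iff]
  rw [← ZMod.val_eq_zero]
  exact Nat.eq_zero_of_dvd_of_lt this x.val_lt

theorem simple_forward
    (p : ℕ) (hp : p.Prime) (G : Type*) [Group G]
    (H : Subgroup G) [H.Normal] (hidx : H.index = p)
    [Finite H] (hne : H ≠ ⊥)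
    (hab : ∀ a b : G, a ∈ H → b ∈ H → a * b = b * a)
    (hpG : IsPGroup p H) 
    (φ : H →* G) (hφ : ∀ N : Subgroup G, N.Normal → ∀ hle : N ≤ H,
        (∀ x, ∀ hx : x ∈ N, φ ⟨x, hle hx⟩ ∈ N) → N = ⊥) :
      ((∃ a : G, a ∉ H ∧ a ^ p = 1) ∧ ∀ h ∈ H, h ^ p = 1) := by
  have : Fact p.Prime := ⟨hp⟩
  have hmp : ∀ a b : G, a ∈ H → b ∈ H → (a * b) ^ p = a ^ p * b ^ p := fun a b ha hb =>
    Commute.mul_pow (hab a b ha hb) p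
  let Ω : Subgroup G :=
    { carrier := {x | x ∈ H ∧ x ^ p = 1}
      one_mem' := ⟨H.one_mem, one_pow _⟩
      mul_mem' := by
        rintro x y ⟨hx, hx1⟩ ⟨hy, hy1⟩
        exact ⟨H.mul_mem hx hy, by rw [hmp x y hx hy, hx1, hy1, one_mul]⟩
      inv_mem' := by
        rintro x ⟨hx, hx1⟩
        exact ⟨H.inv_mem hx, by rw [inv_pow, hx1, inv_one]⟩ }
  have hΩn : Ω.Normal := ⟨by
    rintro x ⟨hx, hx1⟩ g
    exact ⟨‹H.Normal›.conj_mem x hx g, by rw [conj_pow, hx1]; simp⟩⟩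
  have hΩne : Ω ≠ ⊥ := by
    have hnt : Nontrivial H := H.nontrivial_iff_ne_bot.mpr hne
    obtain ⟨n, hn, hc⟩ := hpG.nontrivial_iff_card.mp hnt
    obtain ⟨x, hx⟩ := exists_prime_orderOf_dvd_card' (G := H) p
      (by rw [hc]; exact dvd_pow_self p hn.ne')
    intro h
    have hxm : (x : G) ∈ Ω := ⟨x.2, by
      have := pow_orderOf_eq_one x
      rw [hx] at this
      exact_mod_cast congrArg Subtype.val this⟩
    rw [h, Subgroup.mem_bot] at hxm
    have : x = 1 := Subtype.ext hxm
    rw [this, orderOf_one] at hx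
    exact hp.one_lt.ne hx
  obtain ⟨h0, h0p, hb⟩ : ∃ h0 : H, h0 ^ p = 1 ∧ φ h0 ∉ H := by
    by_contra! hcon
    refine hΩne (hφ Ω hΩn (fun x hx => hx.1) ?_)
    intro x hx
    have h1 : (⟨x, hx.1⟩ : H) ^ p = 1 := Subtype.ext hx.2
    exact ⟨hcon _ h1, by rw [← map_pow, h1, map_one]⟩
  refine ⟨⟨φ h0, hb, by rw [← map_pow, h0p, map_one]⟩, ?_⟩
  let P : Subgroup G :=
    { carrier := {x | ∃ y ∈ H, y ^ p = x}
      one_mem' := ⟨1, H.one_mem, one_pow _⟩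
      mul_mem' := by
        rintro _ _ ⟨x, hx, rfl⟩ ⟨y, hy, rfl⟩
        exact ⟨x * y, H.mul_mem hx hy, hmp x y hx hy⟩
      inv_mem' := by
        rintro _ ⟨x, hx, rfl⟩
        exact ⟨x⁻¹, H.inv_mem hx, inv_pow _ _⟩ }
  have hPn : P.Normal := ⟨by
    rintro _ ⟨x, hx, rfl⟩ g
    exact ⟨g * x * g⁻¹, ‹H.Normal›.conj_mem x hx g, conj_pow⟩⟩
  have hPb : P = ⊥ := by
    refine hφ P hPn (by rintro _ ⟨x, hx, rfl⟩; exact H.pow_mem hx p) ?_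
    rintro _ ⟨x, hx, rfl⟩
    obtain ⟨n, hn⟩ := exists_zpow p hp G H hidx _ hb (φ ⟨x, hx⟩)
    refine ⟨_, hn, ?_⟩
    rw [← map_zpow, ← map_mul, ← map_pow]
    congr 1
    have hc : Commute (⟨x, hx⟩ : H) (h0 ^ n) := Subtype.ext (hab _ _ hx (h0 ^ n).2)
    rw [hc.mul_pow, ← zpow_natCast (h0 ^ n), zpow_comm, zpow_natCast, h0p, one_zpow, mul_one]
    rfl
  intro h hh
  have : h ^ p ∈ P := ⟨h, hh, rfl⟩
  rwa [hPb, Subgroup.mem_bot] at this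

lemma exists_shift_group (p : ℕ) (hp : p.Prime) (A : Type*) [CommGroup A] [Finite A]
    (hel : ∀ x : A, x ^ p = 1) (Z : Subgroup A) :
    ∃ (f : A →* A) (g : A →* Multiplicative (ZMod p)), (∀ x, f x ∈ Z) ∧
      ∀ M : Set A, (∀ x ∈ M, x ∈ Z) → (∀ x ∈ M, f x ∈ M ∧ g x = 1) → ∀ x ∈ M, x = 1 := by
  have : Fact p.Prime := ⟨hp⟩
  let _ : Module (ZMod p) (Additive A) := AddCommGroup.zmodModule (n := p) (fun x => hel x.toMul)
  let S : Submodule (ZMod p) (Additive A) := AddSubgroup.toZModSubmodule p Z.toAddSubgroup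
  have : Finite (Additive A) := ‹Finite A›
  have : Module.Finite (ZMod p) S := Module.Finite.of_finite
  obtain ⟨f, g, hfg⟩ := exists_shift (ZMod p) S
  obtain ⟨P, hP⟩ := LinearMap.exists_leftInverse_of_injective S.subtype
    (LinearMap.ker_eq_bot.mpr S.injective_subtype)
  have hP' : ∀ x : S, P x = x := fun x => LinearMap.congr_fun hP x
  refine ⟨AddMonoidHom.toMultiplicative (S.subtype ∘ₗ f ∘ₗ P).toAddMonoidHom,
    AddMonoidHom.toMultiplicative (g ∘ₗ P).toAddMonoidHom, ?_, ?_⟩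
  · intro x
    exact (f (P (Additive.ofMul x))).2
  · intro M hMZ hM x hx
    have hz := hfg {s | (s : Additive A).toMul ∈ M} (by
      intro s hs
      obtain ⟨h1, h2⟩ := hM _ hs
      change ((f (P s) : S) : Additive A).toMul ∈ M at h1
      change g (P s) = 0 at h2
      rw [hP'] at h1 h2
      exact ⟨h1, h2⟩) ⟨Additive.ofMul x, hMZ x hx⟩ hx
    exact congrArg (fun s : S => (s : Additive A).toMul) hz

theorem simple_backward
    (p : ℕ) (hp : p.Prime) (G : Type*) [Group G]
    (H : Subgroup G) [H.Normal]
    [Finite H]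
    (hab : ∀ a b : G, a ∈ H → b ∈ H → a * b = b * a)
    (hpG : IsPGroup p H) 
    (a : G) (ha : a ∉ H) (hap : a ^ p = 1) (hel : ∀ h ∈ H, h ^ p = 1) :
    (∃ φ : H →* G, ∀ N : Subgroup G, N.Normal → ∀ hle : N ≤ H,
        (∀ x, ∀ hx : x ∈ N, φ ⟨x, hle hx⟩ ∈ N) → N = ⊥) := by
  have : Fact p.Prime := ⟨hp⟩
  let _ : CommGroup H := { (inferInstance : Group H) with
    mul_comm := fun x y => Subtype.ext (hab x y x.2 y.2) }
  obtain ⟨f, g, hfZ, hfg⟩ := exists_shift_group p hp H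
    (fun x => Subtype.ext (hel _ x.2)) ((Subgroup.centralizer {a}).subgroupOf H)
  have hZ : ∀ x : H, x ∈ (Subgroup.centralizer {a}).subgroupOf H ↔ a * x = x * a := by
    intro x
    rw [Subgroup.mem_subgroupOf, Subgroup.mem_centralizer_singleton_iff]
    exact eq_comm
  let ψ : H → G := fun x => (f x : G) * a ^ (g x).toAdd.val
  have hψ : ∀ x y, ψ (x * y) = ψ x * ψ y := by
    intro x y
    have hpw : a ^ (g (x * y)).toAdd.val = a ^ (g x).toAdd.val * a ^ (g y).toAdd.val := by
      rw [map_mul, toAdd_mul, ZMod.val_add, ← pow_add, ← pow_eq_pow_mod _ hap]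
    have hc : Commute a (f y : G) := (hZ _).mp (hfZ y)
    have := (hc.pow_left (g x).toAdd.val).eq
    have hf : (f (x * y) : G) = f x * f y := by rw [map_mul]; rfl
    simp only [ψ, hpw, hf]
    simp only [mul_assoc]
    rw [← mul_assoc (a ^ _) (f y : G), this]
    simp only [mul_assoc]
  refine ⟨MonoidHom.mk' ψ hψ, ?_⟩
  intro N hNn hle hinv
  by_contra hNe
  have : Finite N := Finite.of_injective _ (Subgroup.inclusion_injective hle)
  have hNp : IsPGroup p N := hpG.of_injective _ (Subgroup.inclusion_injective hle)
  obtain ⟨x, hxN, hx1, hxa⟩ := exists_central p hp G N hNp hNe a hap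
  have hz := hfg {s | (s : G) ∈ N ∧ a * s = s * a} (fun s hs => (hZ s).mpr hs.2) (by
    intro s hs
    have h1 : (f s : G) * a ^ (g s).toAdd.val ∈ N := hinv s hs.1
    have h2 : (g s).toAdd = 0 := by
      apply pow_mem_imp p hp G H a ha hap
      exact (H.mul_mem_cancel_left (f s).2).mp (hle h1)
    refine ⟨⟨?_, (hZ _).mp (hfZ s)⟩, h2⟩
    simpa [h2] using h1) ⟨x, hle hxN⟩ ⟨hxN, hxa⟩
  exact hx1 (congrArg Subtype.val hz)

/-- **Theorem (main, virtual endomorphism form).**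
Let `p` be a prime and `G` a group with a normal subgroup `H` of index `p`
such that `H` is a finite, nontrivial, abelian `p`-group.  Then there exists a
simple virtual endomorphism `φ : H → G` (one whose only `φ`-invariant normal
subgroup of `G` contained in `H` is trivial) if and only if the extension
splits (there is `a ∈ G \ H` with `a ^ p = 1`) and `H` is elementary abelian
(every element of `H` has order dividing `p`). -/
theorem finite_p_group_simple_virtual_endomorphism_iff
    (p : ℕ) (hp : p.Prime) (G : Type*) [Group G]
    (H : Subgroup G) [H.Normal] (hidx : H.index = p)
    [Finite H] (hne : H ≠ ⊥)
    (hab : ∀ a b : G, a ∈ H → b ∈ H → a * b = b * a)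
    (hpG : IsPGroup p H) :
    (∃ φ : H →* G, ∀ N : Subgroup G, N.Normal → ∀ hle : N ≤ H,
        (∀ x, ∀ hx : x ∈ N, φ ⟨x, hle hx⟩ ∈ N) → N = ⊥) ↔
      ((∃ a : G, a ∉ H ∧ a ^ p = 1) ∧ ∀ h ∈ H, h ^ p = 1) := by
  constructor
  · rintro ⟨φ, hφ⟩
    exact simple_forward p hp G H hidx hne hab hpG φ hφ
  · rintro ⟨⟨a, ha, hap⟩, hel⟩
    exact simple_backward p hp G H hab hpG a ha hap hel
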